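/- arXiv:1911.08561 — 5 statements merged into one kernel-verified Lean document; each statement's English description precedes it below -/
import Mathlib

section
/- Let A, B be bounded right ℍ-linear operators on V with AB = BA. Then the approximate point S-spectrum of their sum is contained in the sum of their approximate point S-spectra: σ_ap(A+B) ⊆ σ_ap(A) + σ_ap(B). -/
open MulOpposite Filter Pointwise

noncomputable section

variable {V : Type*} [NormedAddCommGroup V] [NormedSpace ℝ V] [CompleteSpace V]
  [Module (Quaternion ℝ)ᵐᵒᵖ V] [IsScalarTower ℝ (Quaternion ℝ)ᵐᵒᵖ V]
  [SMulCommClass ℝ (Quaternion ℝ)ᵐᵒᵖ V]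

/-- `A` is a (bounded) right `ℍ`-linear operator: a bounded real-linear operator on `V`
commuting with the right scalar multiplication by quaternions. -/
def RightLinear (A : V →L[ℝ] V) : Prop :=
  ∀ (q : Quaternion ℝ) (v : V), A (op q • v) = op q • A v

/-- The pseudo-resolvent operator `R_q(A) = A² - 2(Re q)A + |q|² I`. -/
def pseudoRes (q : Quaternion ℝ) (A : V →L[ℝ] V) : V →L[ℝ] V :=
  A.comp A - (2 * q.re) • A + ‖q‖ ^ 2 • ContinuousLinearMap.id ℝ V

/-- The approximate point S-spectrum of `A`. -/
def sigmaAp (A : V →L[ℝ] V) : Set (Quaternion ℝ) :=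
  {q | ∃ φ : ℕ → V, (∀ n, ‖φ n‖ = 1) ∧
    Tendsto (fun n => ‖pseudoRes q A (φ n)‖) atTop (nhds 0)}

/-- The surjectivity S-spectrum of `A`. -/
def sigmaSu (A : V →L[ℝ] V) : Set (Quaternion ℝ) :=
  {q | ¬ Function.Surjective (pseudoRes q A)}

/-- The S-spectrum of `A`. -/
def sigmaS (A : V →L[ℝ] V) : Set (Quaternion ℝ) :=
  {q | ¬ Function.Bijective (pseudoRes q A)}


lemma aux_approx_eig {Q : Type*} [NormedAddCommGroup Q] [NormedSpace ℂ Q] [CompleteSpace Q]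
    [Nontrivial Q] (T : Q →L[ℂ] Q) :
    ∃ l : ℂ, ∀ ε > 0, ∃ x : Q, ‖T x - l • x‖ < ε * ‖x‖ := by
  have hne := spectrum.nonempty T
  have hcpt := spectrum.isCompact (𝕜 := ℂ) T
  have hnu : spectrum ℂ T ≠ Set.univ := fun h => by
    rw [h] at hcpt
    exact noncompact_univ ℂ hcpt
  obtain ⟨l, hl⟩ := (nonempty_frontier_iff (s := spectrum ℂ T)).2 ⟨hne, hnu⟩
  refine ⟨l, fun ε hε => ?_⟩
  by_contra! hc
  have hls : l ∈ spectrum ℂ T := hcpt.isClosed.frontier_subset hl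
  rw [frontier_eq_closure_inter_closure] at hl
  obtain ⟨m, hm, hd⟩ := Metric.mem_closure_iff.1 hl.2 (ε / 2) (by positivity)
  have hm' : IsUnit (algebraMap ℂ (Q →L[ℂ] Q) m - T) := by
    simpa [spectrum.mem_iff] using hm
  obtain ⟨u, hu⟩ := hm'
  have hb : ∀ x, ε / 2 * ‖x‖ ≤ ‖(u : Q →L[ℂ] Q) x‖ := fun x => by
    have h1 : (u : Q →L[ℂ] Q) x = m • x - T x := by
      rw [hu]; simp [Algebra.algebraMap_eq_smul_one]
    have h2 : T x - l • x = (m - l) • x - (u : Q →L[ℂ] Q) x := by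
      rw [h1, sub_smul]; abel
    have h3 := hc x
    rw [h2] at h3
    have h4 := norm_sub_le ((m - l) • x) ((u : Q →L[ℂ] Q) x)
    rw [norm_smul] at h4
    rw [dist_comm, dist_eq_norm] at hd
    nlinarith [norm_nonneg x]
  have hinv : ‖(↑u⁻¹ : Q →L[ℂ] Q)‖ ≤ (ε / 2)⁻¹ := by
    refine ContinuousLinearMap.opNorm_le_bound _ (by positivity) fun x => ?_
    have h1 := hb ((↑u⁻¹ : Q →L[ℂ] Q) x)
    rw [← mul_apply_eq_comp, Units.mul_inv, one_apply_eq_self] at h1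
    rw [inv_mul_eq_div, le_div_iff₀' (by positivity)]
    exact h1
  apply hls
  have hlt : ‖(algebraMap ℂ (Q →L[ℂ] Q) l - T) - u‖ < ‖(↑u⁻¹ : Q →L[ℂ] Q)‖⁻¹ := by
    have : (algebraMap ℂ (Q →L[ℂ] Q) l - T) - u = algebraMap ℂ (Q →L[ℂ] Q) (l - m) := by
      rw [hu, map_sub]; abel
    rw [this, norm_algebraMap', ← dist_eq_norm]
    refine hd.trans_le ?_
    rw [le_inv_comm₀ (by positivity) (Units.norm_pos _)]
    exact hinv
  exact (u.ofNearby _ hlt).isUnit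

def auxK {E : Type*} [NormedAddCommGroup E] [NormedSpace ℂ E] (D : E →L[ℂ] E) :
    Submodule ℂ (BoundedContinuousFunction ℕ E) where
  carrier := {f | Tendsto (fun n => D (f n)) atTop (nhds 0)}
  add_mem' := fun {f g} hf hg => by
    simpa using Tendsto.add hf hg
  zero_mem' := by simp
  smul_mem' := fun c f hf => by
    simpa using Tendsto.const_smul hf c

lemma auxK_closed {E : Type*} [NormedAddCommGroup E] [NormedSpace ℂ E] (D : E →L[ℂ] E) :
    IsClosed (auxK D : Set (BoundedContinuousFunction ℕ E)) := by
  refine isClosed_of_closure_subset fun f hf => ?_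
  change Tendsto (fun n => D (f n)) atTop (nhds 0)
  rw [Metric.tendsto_atTop]
  intro ε hε
  obtain ⟨g, hg, hd⟩ := Metric.mem_closure_iff.1 hf (ε / (2 * (‖D‖ + 1))) (by positivity)
  obtain ⟨N, hN⟩ := Metric.tendsto_atTop.1 (show Tendsto (fun n => D (g n)) atTop (nhds 0) from hg)
    (ε / 2) (by positivity)
  refine ⟨N, fun n hn => ?_⟩
  have h1 := hN n hn
  rw [dist_zero_right] at h1 ⊢
  have h2 : ‖f n - g n‖ < ε / (2 * (‖D‖ + 1)) := by
    rw [← dist_eq_norm]; exact (BoundedContinuousFunction.dist_coe_le_dist n).trans_lt hd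
  have h3 : ‖D (f n - g n)‖ ≤ ε / 2 := by
    refine (D.le_opNorm _).trans ?_
    have := mul_le_mul (le_add_of_nonneg_right zero_le_one : ‖D‖ ≤ ‖D‖ + 1) h2.le (norm_nonneg _)
      (by positivity)
    refine this.trans_eq ?_
    have : ‖D‖ + 1 ≠ 0 := by positivity
    field_simp
  have h4 : D (f n) = D (f n - g n) + D (g n) := by simp
  rw [h4]
  exact (norm_add_le _ _).trans_lt (by linarith)

lemma aux_joint {E : Type*} [NormedAddCommGroup E] [NormedSpace ℂ E] [CompleteSpace E]
    (A D : E →L[ℂ] E) (hc : ∀ x, A (D x) = D (A x))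
    (hD : ∀ ε > 0, ∃ x : E, ‖x‖ = 1 ∧ ‖D x‖ < ε) :
    ∃ l : ℂ, ∀ ε > 0, ∃ x : E, ‖x‖ = 1 ∧ ‖A x - l • x‖ < ε ∧ ‖D x‖ < ε := by
  have hcl := auxK_closed D
  let K := auxK D
  let N : Submodule ℂ K := (auxK (ContinuousLinearMap.id ℂ E)).comap K.subtype
  have hNcl : IsClosed (N : Set K) :=
    (auxK_closed (ContinuousLinearMap.id ℂ E)).preimage continuous_subtype_val
  have : CompleteSpace K := hcl.completeSpace_coe
  have := hNcl
  have memK : ∀ f : BoundedContinuousFunction ℕ E, f ∈ K ↔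
    Tendsto (fun n => D (f n)) atTop (nhds 0) := fun f => Iff.rfl
  have memN : ∀ f : K, f ∈ N ↔ Tendsto (fun n => f.1 n) atTop (nhds 0) := fun f => Iff.rfl
  let A1 : K →L[ℂ] K :=
    ((A.compLeftContinuousBounded ℕ).comp K.subtypeL).codRestrict K (fun f => by
      rw [memK]
      have := (A.continuous.tendsto 0).comp ((memK _).1 f.2)
      simpa [Function.comp_def, hc] using this)
  have A1a : ∀ f n, (A1 f).1 n = A (f.1 n) := fun f n => rfl
  let T : (K ⧸ N) →L[ℂ] (K ⧸ N) := N.liftQL (N.mkQL.comp A1) (by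
    intro f hf
    have hf := (memN f).1 hf
    have : A1 f ∈ N := by
      rw [memN]
      have := (A.continuous.tendsto 0).comp hf
      simpa [Function.comp_def, A1a] using this
    simpa using this)
  have Ta : ∀ f : K, T (Submodule.Quotient.mk f) = Submodule.Quotient.mk (A1 f) := fun f => rfl
  have : Nontrivial (K ⧸ N) := by
    choose φ h1 h2 using fun n : ℕ => hD (1 / ((n : ℝ) + 1)) (by positivity)
    let f : BoundedContinuousFunction ℕ E :=
      BoundedContinuousFunction.ofNormedAddCommGroup φ continuous_of_discreteTopology 1
        (fun n => (h1 n).le)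
    have hf : f ∈ K := by
      rw [memK]
      exact squeeze_zero_norm (fun n => (h2 n).le) tendsto_one_div_add_atTop_nhds_zero_nat
    refine ⟨⟨Submodule.Quotient.mk ⟨f, hf⟩, 0, fun h => ?_⟩⟩
    rw [Submodule.Quotient.mk_eq_zero, memN] at h
    have h' : Tendsto (fun n => ‖φ n‖) atTop (nhds 0) := by
      have := h.norm
      rw [norm_zero] at this
      exact this
    simp only [h1] at h'
    exact one_ne_zero (tendsto_nhds_unique tendsto_const_nhds h')
  obtain ⟨l, hl⟩ := aux_approx_eig (Q := K ⧸ N) T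
  refine ⟨l, fun ε hε => ?_⟩
  obtain ⟨x, hx⟩ := hl (ε / 2) (by positivity)
  obtain ⟨f, rfl⟩ := Submodule.Quotient.mk_surjective N x
  rw [Ta, ← Submodule.Quotient.mk_smul, ← Submodule.Quotient.mk_sub] at hx
  set r := ‖(Submodule.Quotient.mk f : K ⧸ N)‖ with hr
  have hr0 : 0 < r := by
    by_contra h
    have := norm_nonneg (Submodule.Quotient.mk (A1 f - l • f) : K ⧸ N)
    nlinarith
  obtain ⟨g, hg, hgn⟩ := (QuotientAddGroup.norm_lt_iff (S := N.toAddSubgroup)).1 hx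
  have hg1 : g - (A1 f - l • f) ∈ N := (Submodule.Quotient.eq N).1 hg
  rw [memN] at hg1
  -- frequently large
  have hfreq : ∃ᶠ n in atTop, 3 / 4 * r < ‖f.1 n‖ := by
    intro h
    obtain ⟨M, hM⟩ := eventually_atTop.1 h
    let k : BoundedContinuousFunction ℕ E :=
      BoundedContinuousFunction.ofNormedAddCommGroup (fun n => if n < M then 0 else f.1 n)
        continuous_of_discreteTopology (3 / 4 * r) (fun n => by
          by_cases hn : n < M
          · simp [hn]; positivity
          · simpa [hn] using hM n (not_lt.1 hn))
    have hkn : ‖k‖ ≤ 3 / 4 * r := by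
      exact BoundedContinuousFunction.norm_ofNormedAddCommGroup_le _ (by positivity) _
    have hev : ∀ᶠ n in atTop, k n = f.1 n := by
      filter_upwards [eventually_ge_atTop M] with n hn
      simp [k, not_lt.2 hn]
    have hk : k ∈ K := by
      rw [memK]
      refine ((memK _).1 f.2).congr' ?_
      filter_upwards [hev] with n hn
      rw [hn]
    have hkf : (Submodule.Quotient.mk ⟨k, hk⟩ : K ⧸ N) = Submodule.Quotient.mk f := by
      rw [Submodule.Quotient.eq, memN]
      refine tendsto_const_nhds.congr' ?_
      filter_upwards [hev] with n hn
      simp [hn]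
    have := Submodule.Quotient.norm_mk_le N (⟨k, hk⟩ : K)
    rw [hkf, ← hr] at this
    have h2 : ‖(⟨k, hk⟩ : K)‖ = ‖k‖ := rfl
    rw [h2] at this
    linarith
  have he1 : ∀ᶠ n in atTop, ‖D (f.1 n)‖ < 3 / 4 * r * ε := by
    have := ((memK _).1 f.2).norm
    rw [norm_zero] at this
    exact this.eventually_lt_const (by positivity)
  have he2 : ∀ᶠ n in atTop, ‖(g - (A1 f - l • f)).1 n‖ < 1 / 4 * r * ε := by
    have := hg1.norm
    rw [norm_zero] at this
    exact this.eventually_lt_const (by positivity)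
  obtain ⟨n, hn, hn1, hn2⟩ := (hfreq.and_eventually (he1.and he2)).exists
  have hpos : 0 < ‖f.1 n‖ := lt_trans (by positivity) hn
  have h3 : ‖A (f.1 n) - l • f.1 n‖ < 3 / 4 * r * ε := by
    have e : A (f.1 n) - l • f.1 n = g.1 n - (g - (A1 f - l • f)).1 n := by
      change _ = g.1 n - (g.1 n - ((A1 f).1 n - l • f.1 n))
      rw [A1a]; abel
    have : ‖g.1 n‖ ≤ ‖g‖ := g.1.norm_coe_le_norm n
    rw [e]
    refine (norm_sub_le _ _).trans_lt ?_
    linarith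
  have key : 3 / 4 * r * ε < ε * ‖f.1 n‖ := by nlinarith
  refine ⟨((‖f.1 n‖⁻¹ : ℝ) : ℂ) • f.1 n, ?_, ?_, ?_⟩
  · rw [norm_smul]; simp [hpos.ne']
  · rw [map_smul, smul_comm l, ← smul_sub, norm_smul]
    simp only [Complex.norm_real, norm_inv, norm_norm]
    rw [inv_mul_lt_iff₀ hpos]; linarith
  · rw [map_smul, norm_smul]
    simp only [Complex.norm_real, norm_inv, norm_norm]
    rw [inv_mul_lt_iff₀ hpos]; linarith

lemma aux_mem (T : V →L[ℝ] V) (q : Quaternion ℝ)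
    (h : ∀ ε > 0, ∃ x : V, ‖x‖ = 1 ∧ ‖pseudoRes q T x‖ < ε) : q ∈ sigmaAp T := by
  choose φ h1 h2 using fun n : ℕ => h (1 / ((n : ℝ) + 1)) (by positivity)
  exact ⟨φ, h1, squeeze_zero (fun _ => norm_nonneg _) (fun n => (h2 n).le)
    tendsto_one_div_add_atTop_nhds_zero_nat⟩

lemma aux_factor [NormedSpace ℂ V] (hr : ∀ (r : ℝ) (v : V), (r : ℂ) • v = r • v)
    (T : V →L[ℝ] V) (T' : V →L[ℂ] V) (hT : ∀ x, T' x = T x) (q : Quaternion ℝ) (l : ℂ)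
    (h1 : q.re = l.re) (h2 : ‖q‖ ^ 2 = l.re ^ 2 + l.im ^ 2) (x : V) :
    pseudoRes q T x = T' (T' x - l • x) - (starRingEnd ℂ l) • (T' x - l • x) := by
  have e1 : l + starRingEnd ℂ l = ((2 * l.re : ℝ) : ℂ) := by
    rw [Complex.add_conj]
  have e2 : starRingEnd ℂ l * l = ((l.re ^ 2 + l.im ^ 2 : ℝ) : ℂ) := by
    rw [mul_comm, Complex.mul_conj, Complex.normSq_apply]; push_cast; ring
  have e3 : pseudoRes q T x = T (T x) - (2 * q.re) • T x + ‖q‖ ^ 2 • x := by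
    simp [pseudoRes]
  rw [e3, h1, h2, ← hr, ← hr, ← e1, ← e2, map_sub, map_smul, ← hT, ← hT, smul_sub, add_smul,
    mul_smul]
  abel

lemma aux_mem' [NormedSpace ℂ V] (hr : ∀ (r : ℝ) (v : V), (r : ℂ) • v = r • v)
    (T : V →L[ℝ] V) (T' : V →L[ℂ] V) (hT : ∀ x, T' x = T x) (q : Quaternion ℝ) (l : ℂ)
    (h1 : q.re = l.re) (h2 : ‖q‖ ^ 2 = l.re ^ 2 + l.im ^ 2)
    (h : ∀ ε > 0, ∃ x : V, ‖x‖ = 1 ∧ ‖T' x - l • x‖ < ε) : q ∈ sigmaAp T := by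
  refine aux_mem T q fun ε hε => ?_
  have hp : 0 < ‖T'‖ + ‖l‖ + 1 := by positivity
  obtain ⟨x, hx, hx2⟩ := h (ε / (‖T'‖ + ‖l‖ + 1)) (by positivity)
  refine ⟨x, hx, ?_⟩
  rw [aux_factor hr T T' hT q l h1 h2]
  rw [lt_div_iff₀ hp] at hx2
  refine (norm_sub_le _ _).trans_lt ?_
  have h3 := T'.le_opNorm (T' x - l • x)
  rw [norm_smul, RCLike.norm_conj]
  nlinarith [norm_nonneg (T' x - l • x)]

lemma aux_mk (a b c d : ℝ) : ∃ u : Quaternion ℝ, u.re = a ∧ u.imI = b ∧ u.imJ = c ∧ u.imK = d :=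
  ⟨⟨a, b, c, d⟩, rfl, rfl, rfl, rfl⟩

lemma aux_unit (q : Quaternion ℝ) : ∃ (u : Quaternion ℝ) (y : ℝ), u.re = 0 ∧
    (u.imI ^ 2 + u.imJ ^ 2 + u.imK ^ 2 = 1) ∧ q = (q.re : Quaternion ℝ) + y • u := by
  by_cases h : q.imI ^ 2 + q.imJ ^ 2 + q.imK ^ 2 = 0
  · obtain ⟨u, h1, h2, h3, h4⟩ := aux_mk 0 1 0 0
    refine ⟨u, 0, h1, by rw [h2, h3, h4]; norm_num, ?_⟩
    have a : q.imI = 0 := by nlinarith [sq_nonneg q.imI, sq_nonneg q.imJ, sq_nonneg q.imK]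
    have b : q.imJ = 0 := by nlinarith [sq_nonneg q.imI, sq_nonneg q.imJ, sq_nonneg q.imK]
    have c : q.imK = 0 := by nlinarith [sq_nonneg q.imI, sq_nonneg q.imJ, sq_nonneg q.imK]
    ext <;> simp [a, b, c]
  · set s := q.imI ^ 2 + q.imJ ^ 2 + q.imK ^ 2 with hs
    have hs0 : 0 < s := lt_of_le_of_ne (by positivity) (Ne.symm h)
    have hq : 0 < √s := Real.sqrt_pos.2 hs0
    have hss : √s ^ 2 = s := Real.sq_sqrt hs0.le
    obtain ⟨u, h1, h2, h3, h4⟩ := aux_mk 0 (q.imI / √s) (q.imJ / √s) (q.imK / √s)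
    refine ⟨u, √s, h1, ?_, ?_⟩
    · simp only [h2, h3, h4, div_pow, hss]
      rw [← add_div, ← add_div, ← hs, div_self h]
    · ext <;> simp [h1, h2, h3, h4] <;> field_simp

lemma aux_normsq (u : Quaternion ℝ) (h0 : u.re = 0)
    (h1 : u.imI ^ 2 + u.imJ ^ 2 + u.imK ^ 2 = 1) (a b : ℝ) :
    ((a : Quaternion ℝ) + b • u).re = a ∧ ‖(a : Quaternion ℝ) + b • u‖ ^ 2 = a ^ 2 + b ^ 2 := by
  refine ⟨by simp [h0], ?_⟩
  rw [sq, ← Quaternion.normSq_eq_norm_mul_self, Quaternion.normSq_def']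
  simp [h0]
  linear_combination b ^ 2 * h1

lemma aux_main [NormedSpace ℂ V] (hr : ∀ (r : ℝ) (v : V), (r : ℂ) • v = r • v)
    (A B : V →L[ℝ] V) (A' B' : V →L[ℂ] V) (hA : ∀ x, A' x = A x) (hB : ∀ x, B' x = B x)
    (hcomm : A.comp B = B.comp A) (J : V →+ V) (hJn : ∀ v, ‖J v‖ = ‖v‖)
    (hJ : ∀ (z : ℂ) v, J (starRingEnd ℂ z • v) = z • J v)
    (hJA : ∀ v, A (J v) = J (A v)) (hJB : ∀ v, B (J v) = J (B v)) :
    sigmaAp (A + B) ⊆ sigmaAp A + sigmaAp B := by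
  rintro q ⟨φ, hφ, hlim⟩
  obtain ⟨u, y, hu0, hu1, hq⟩ := aux_unit q
  let z : ℂ := ⟨q.re, y⟩
  have hz : ‖q‖ ^ 2 = z.re ^ 2 + z.im ^ 2 := by
    have := (aux_normsq u hu0 hu1 q.re y).2
    rwa [← hq] at this
  have hAB : ∀ x, A (B x) = B (A x) := fun x => congrArg (fun T : V →L[ℝ] V => T x) hcomm
  let C' : V →L[ℂ] V := A' + B'
  have hC : ∀ x, C' x = (A + B) x := fun x => by simp [C', hA, hB]
  let D : V →L[ℂ] V := C' - z • ContinuousLinearMap.id ℂ V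
  have hDx : ∀ x, D x = C' x - z • x := fun x => by simp [D]
  have hfac : ∀ x, pseudoRes q (A + B) x = C' (D x) - (starRingEnd ℂ z) • D x := fun x => by
    rw [aux_factor hr (A + B) C' hC q z rfl hz, hDx]
  have hD : ∀ ε > 0, ∃ x : V, ‖x‖ = 1 ∧ ‖D x‖ < ε := by
    intro ε hε
    by_contra! hcon
    obtain ⟨n, hn⟩ := (hlim.eventually_lt_const (show 0 < ε * ε by positivity)).exists
    have h1 := hcon _ (hφ n)
    set w := D (φ n) with hw
    have hwpos : 0 < ‖w‖ := hε.trans_le h1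
    have h2 : D (J w) = J (C' w - (starRingEnd ℂ z) • w) := by
      rw [hDx, map_sub, hJ, hC, hC]
      simp [hJA, hJB]
    have h3 : ‖D (J w)‖ < ε * ε := by
      rw [h2, hJn, hw, ← hfac]; exact hn
    have h4 := hcon (((‖w‖⁻¹ : ℝ) : ℂ) • J w) (by
      rw [norm_smul, hJn]; simp [hwpos.ne'])
    rw [map_smul, norm_smul] at h4
    simp only [Complex.norm_real, norm_inv, norm_norm] at h4
    rw [le_inv_mul_iff₀ hwpos] at h4
    nlinarith
  obtain ⟨l, hl⟩ := aux_joint A' D (fun x => by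
    rw [hDx, hDx, map_sub, map_smul]
    simp [C', hA, hB, hAB]) hD
  have hn1 := aux_normsq u hu0 hu1 l.re l.im
  have hn2 := aux_normsq u hu0 hu1 (z - l).re (z - l).im
  refine Set.mem_add.2 ⟨_, aux_mem' hr A A' hA _ l hn1.1 hn1.2 fun ε hε => ?_,
    _, aux_mem' hr B B' hB _ (z - l) hn2.1 hn2.2 fun ε hε => ?_, ?_⟩
  · obtain ⟨x, h1, h2, -⟩ := hl ε hε
    exact ⟨x, h1, h2⟩
  · obtain ⟨x, h1, h2, h3⟩ := hl (ε / 2) (by positivity)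
    refine ⟨x, h1, ?_⟩
    have : B' x - (z - l) • x = D x - (A' x - l • x) := by
      rw [hDx, sub_smul]; simp [C']; abel
    rw [this]
    exact (norm_sub_le _ _).trans_lt (by linarith)
  · conv_rhs => rw [hq]
    have e1 : (z - l).re = q.re - l.re := rfl
    have e2 : (z - l).im = y - l.im := rfl
    rw [e1, e2, sub_smul, Quaternion.coe_sub]
    abel

theorem sigmaAp_add_subset (hnorm : ∀ (q : Quaternion ℝ) (v : V), ‖op q • v‖ = ‖v‖ * ‖q‖)
    (A B : V →L[ℝ] V) (hA : RightLinear A) (hB : RightLinear B)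
    (hcomm : A.comp B = B.comp A) :
    sigmaAp (A + B) ⊆ sigmaAp A + sigmaAp B := by
  let ι : ℂ →+* (Quaternion ℝ)ᵐᵒᵖ :=
    (Quaternion.ofComplex : ℂ →ₐ[ℝ] Quaternion ℝ).toRingHom.toOpposite (fun x y => by
      change _ * _ = _ * _
      rw [← map_mul, ← map_mul, mul_comm])
  let m : Module ℂ V := Module.compHom V ι
  have hs : ∀ (z : ℂ) (v : V), z • v = op (z : Quaternion ℝ) • v := fun z v => rfl
  let ns : NormedSpace ℂ V := { m with
    norm_smul_le := fun z v => by
      have e : ‖(z : Quaternion ℝ)‖ = ‖z‖ := by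
        rw [← sq_eq_sq₀ (norm_nonneg _) (norm_nonneg _), sq,
          ← Quaternion.normSq_eq_norm_mul_self, Quaternion.normSq_def',
          ← Complex.normSq_eq_norm_sq, Complex.normSq_apply]
        simp; ring
      rw [hs, hnorm, mul_comm, e] }
  have hr : ∀ (r : ℝ) (v : V), (r : ℂ) • v = r • v := fun r v => by
    have e : op (((r : ℂ) : Quaternion ℝ)) = r • (1 : (Quaternion ℝ)ᵐᵒᵖ) := by
      change op _ = op (r • (1 : Quaternion ℝ))
      have o1 : (1 : Quaternion ℝ).re = 1 := rfl
      have o2 : (1 : Quaternion ℝ).imI = 0 := rfl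
      have o3 : (1 : Quaternion ℝ).imJ = 0 := rfl
      have o4 : (1 : Quaternion ℝ).imK = 0 := rfl
      congr 1; ext <;> simp [o1, o2, o3, o4]
    rw [hs, e, smul_assoc, one_smul]
  let A' : V →L[ℂ] V := ⟨⟨⟨A, map_add A⟩, fun z v => hA z v⟩, A.continuous⟩
  let B' : V →L[ℂ] V := ⟨⟨⟨B, map_add B⟩, fun z v => hB z v⟩, B.continuous⟩
  obtain ⟨j, j1, j2, j3, j4⟩ := aux_mk 0 0 1 0
  have hj : ‖j‖ = 1 := by
    have : ‖j‖ * ‖j‖ = 1 := by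
      rw [← Quaternion.normSq_eq_norm_mul_self, Quaternion.normSq_def']; simp [j1, j2, j3, j4]
    nlinarith [norm_nonneg j]
  refine aux_main hr A B A' B' (fun _ => rfl) (fun _ => rfl) hcomm
    (DistribSMul.toAddMonoidHom V (op j)) ?_ ?_ (fun v => hA j v) (fun v => hB j v)
  · intro v
    change ‖op j • v‖ = ‖v‖
    rw [hnorm, hj, mul_one]
  · intro z v
    change op j • (starRingEnd ℂ z • v) = z • (op j • v)
    rw [hs, hs, smul_smul, smul_smul, ← op_mul, ← op_mul]
    congr 2
    ext <;> simp [j1, j2, j3, j4]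
end
end

section
/- Let A, B be bounded right ℍ-linear operators on V with AB = BA. Then the S-spectrum of their sum is contained in the sum of their S-spectra: σ_S(A+B) ⊆ σ_S(A) + σ_S(B). -/
open MulOpposite Filter Pointwise

noncomputable section

variable {V : Type*} [NormedAddCommGroup V] [NormedSpace ℝ V] [CompleteSpace V]
  [Module (Quaternion ℝ)ᵐᵒᵖ V] [IsScalarTower ℝ (Quaternion ℝ)ᵐᵒᵖ V]
  [SMulCommClass ℝ (Quaternion ℝ)ᵐᵒᵖ V]

theorem aux_char {S : Type*} [NormedCommRing S] [NormedAlgebra ℝ S] [CompleteSpace S]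
    (j : S) (hj : j * j = -1) (hn : ∀ (z : ℂ) (x : S), ‖(z.re • 1 + z.im • j) * x‖ ≤ ‖z‖ * ‖x‖)
    (x : S) (hx : ¬ IsUnit x) : ∃ h : S →+* ℂ, (∀ (r : ℝ) (y : S), h (r • y) = r * h y) ∧ h x = 0 := by
  have hreal : ∀ (r : ℝ) (y : S), ((r : ℂ).re • (1 : S) + (r : ℂ).im • j) * y = r • y := by
    intro r y
    simp
  let alg : Algebra ℂ S := (Complex.lift ⟨j, hj⟩ : ℂ →ₐ[ℝ] S).toRingHom.toAlgebra
  have hs : ∀ (z : ℂ) (x : S), z • x = (z.re • 1 + z.im • j) * x := by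
    intro z x
    rw [Algebra.smul_def]
    congr 1
    change Complex.lift ⟨j, hj⟩ z = _
    simp [Complex.lift, Complex.liftAux_apply, Algebra.algebraMap_eq_smul_one]
  let : NormedAlgebra ℂ S := { alg with norm_smul_le := fun z x => (congrArg norm (hs z x)).le.trans (hn z x) }
  obtain ⟨f, hf⟩ := WeakDual.CharacterSpace.exists_apply_eq_zero hx
  refine ⟨(WeakDual.CharacterSpace.toAlgHom f).toRingHom, ?_, hf⟩
  intro r y
  rw [← hreal, ← hs]
  change f _ = _ * f y
  rw [map_smul]
  rfl

theorem aux_quat (q : Quaternion ℝ) : ∃ (y : ℝ) (J : Quaternion ℝ), J.re = 0 ∧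
    J.imI ^ 2 + J.imJ ^ 2 + J.imK ^ 2 = 1 ∧ q = (q.re : Quaternion ℝ) + y • J := by
  by_cases h : q.imI ^ 2 + q.imJ ^ 2 + q.imK ^ 2 = 0
  · refine ⟨0, ⟨0, 1, 0, 0⟩, rfl, by norm_num, ?_⟩
    have h1 : q.imI = 0 := by nlinarith [sq_nonneg q.imI, sq_nonneg q.imJ, sq_nonneg q.imK]
    have h2 : q.imJ = 0 := by nlinarith [sq_nonneg q.imI, sq_nonneg q.imJ, sq_nonneg q.imK]
    have h3 : q.imK = 0 := by nlinarith [sq_nonneg q.imI, sq_nonneg q.imJ, sq_nonneg q.imK]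
    apply Quaternion.ext
    · change q.re = q.re + 0 * 0
      ring
    · change q.imI = 0 + 0 * 1
      rw [h1]; ring
    · change q.imJ = 0 + 0 * 0
      rw [h2]; ring
    · change q.imK = 0 + 0 * 0
      rw [h3]; ring
  · have hp : 0 < q.imI ^ 2 + q.imJ ^ 2 + q.imK ^ 2 := lt_of_le_of_ne (by positivity) (Ne.symm h)
    set y := Real.sqrt (q.imI ^ 2 + q.imJ ^ 2 + q.imK ^ 2) with hy
    have hy0 : 0 < y := Real.sqrt_pos.2 hp
    have hy2 : y ^ 2 = q.imI ^ 2 + q.imJ ^ 2 + q.imK ^ 2 := Real.sq_sqrt hp.le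
    refine ⟨y, ⟨0, q.imI / y, q.imJ / y, q.imK / y⟩, rfl, ?_, ?_⟩
    · simp only [div_pow]
      rw [← add_div, ← add_div, ← hy2]
      exact div_self (by positivity)
    · apply Quaternion.ext
      · change q.re = q.re + y * 0
        ring
      · change q.imI = 0 + y * (q.imI / y)
        field_simp
        ring
      · change q.imJ = 0 + y * (q.imJ / y)
        field_simp
        ring
      · change q.imK = 0 + y * (q.imK / y)
        field_simp
        ring

theorem aux_norm (J : Quaternion ℝ) (h0 : J.re = 0) (h1 : J.imI ^ 2 + J.imJ ^ 2 + J.imK ^ 2 = 1)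
    (a b : ℝ) : ‖(a : Quaternion ℝ) + b • J‖ ^ 2 = a ^ 2 + b ^ 2 := by
  rw [sq, ← Quaternion.normSq_eq_norm_mul_self, Quaternion.normSq_def']
  simp [h0]
  linear_combination b ^ 2 * h1

theorem aux_complex (x y : ℝ) (z : ℂ) (h : z * z - (2 * x : ℝ) * z + ((x ^ 2 + y ^ 2 : ℝ) : ℂ) = 0) :
    z.re = x ∧ (z.im = y ∨ z.im = -y) := by
  have h2 : (z - (x + y * Complex.I)) * (z - (x - y * Complex.I)) = 0 := by
    push_cast at h
    linear_combination h - y ^ 2 * Complex.I_sq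
  rcases mul_eq_zero.1 h2 with h | h
  · rw [sub_eq_zero.1 h]; simp
  · rw [sub_eq_zero.1 h]; simp

theorem sigmaS_add_subset (hnorm : ∀ (q : Quaternion ℝ) (v : V), ‖op q • v‖ = ‖v‖ * ‖q‖)
    (A B : V →L[ℝ] V) (hA : RightLinear A) (hB : RightLinear B)
    (hcomm : A.comp B = B.comp A) :
    sigmaS (A + B) ⊆ sigmaS A + sigmaS B := by
  intro q hq
  obtain ⟨y, J, hJ0, hJ1, hqJ⟩ := aux_quat q
  have hqn : ‖q‖ ^ 2 = q.re ^ 2 + y ^ 2 := by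
    conv_lhs => rw [hqJ]
    exact aux_norm J hJ0 hJ1 _ _
  -- the complex structure
  have hJJ : J * J = -1 := by
    have h1 := Quaternion.sq_eq_neg_normSq.2 hJ0
    have h2 : Quaternion.normSq J = 1 := by
      rw [Quaternion.normSq_def', hJ0]
      linarith
    rw [h2, sq] at h1
    simpa using h1
  have hsm : ∀ (r : ℝ) (v : V), r • v = op (r : Quaternion ℝ) • v := by
    intro r v
    have : op (r : Quaternion ℝ) = r • (1 : (Quaternion ℝ)ᵐᵒᵖ) := by
      rw [← op_one, ← op_smul]
      congr 1
      rw [← Quaternion.coe_mul_eq_smul, mul_one]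
    rw [this, smul_assoc, one_smul]
  let T : V →L[ℝ] V := LinearMap.mkContinuous
    { toFun := fun v => op J • v
      map_add' := fun v w => smul_add _ _ _
      map_smul' := fun r v => (smul_comm r (op J) v).symm } 1 (fun v => by
        have h1 : ‖J‖ ^ 2 = 1 := by
          have := aux_norm J hJ0 hJ1 0 1
          simpa using this
        have h2 : ‖J‖ = 1 := by nlinarith [norm_nonneg J]
        change ‖op J • v‖ ≤ _
        rw [hnorm, h2, mul_comm])
  have hT : ∀ v, T v = op J • v := fun v => rfl
  have hTT : T * T = -1 := by
    ext v
    change op J • op J • v = - v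
    rw [smul_smul, ← op_mul, hJJ, op_neg, op_one, neg_smul, one_smul]
  have hTn : ∀ (z : ℂ) (X : V →L[ℝ] V), ‖(z.re • 1 + z.im • T) * X‖ ≤ ‖z‖ * ‖X‖ := by
    intro z X
    refine (norm_mul_le _ _).trans ?_
    gcongr
    refine ContinuousLinearMap.opNorm_le_bound _ (norm_nonneg _) fun v => ?_
    have : (z.re • (1 : V →L[ℝ] V) + z.im • T) v = op ((z.re : Quaternion ℝ) + z.im • J) • v := by
      change z.re • v + z.im • op J • v = _
      rw [hsm z.re, op_add, add_smul, op_smul, smul_assoc]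
    rw [this, hnorm, mul_comm]
    gcongr
    refine le_of_eq ?_
    rw [← sq_eq_sq₀ (norm_nonneg _) (norm_nonneg _), aux_norm J hJ0 hJ1, Complex.sq_norm,
      Complex.normSq_apply]
    ring
  have hAT : A * T = T * A := by ext v; exact hA J v
  have hBT : B * T = T * B := by ext v; exact hB J v
  have hAB : A * B = B * A := hcomm
  -- the commutative Banach algebra
  let s : Set (V →L[ℝ] V) := {A, B, T}
  let S : Subalgebra ℝ (V →L[ℝ] V) := Subalgebra.centralizer ℝ s.centralizer
  have hSc : ∀ x ∈ S, ∀ y ∈ S, x * y = y * x := by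
    apply Set.centralizer_centralizer_comm_of_comm
    rintro x (rfl | rfl | rfl) y (rfl | rfl | rfl) <;> first | rfl | assumption | (symm; assumption)
  have hsS : s ⊆ S := Set.subset_centralizer_centralizer
  have hSclosed : IsClosed (S : Set (V →L[ℝ] V)) := Set.isClosed_centralizer _
  let : NormedCommRing S :=
    { (inferInstance : NormedRing S) with
      mul_comm := fun x y => Subtype.ext (hSc x x.2 y y.2) }
  let : NormedAlgebra ℝ S := S.toNormedAlgebra
  have : CompleteSpace S := hSclosed.completeSpace_coe
  have hunit : ∀ x : S, IsUnit (x : V →L[ℝ] V) → IsUnit x := by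
    intro x hx
    obtain ⟨u, hu⟩ := hx
    have hm : (↑u⁻¹ : V →L[ℝ] V) ∈ S := by
      intro g hg
      have h1 : Commute g (u : V →L[ℝ] V) := by rw [hu]; exact x.2 g hg
      exact h1.units_inv_right
    refine IsUnit.of_mul_eq_one (⟨_, hm⟩ : S) ?_
    apply Subtype.ext
    change (x : V →L[ℝ] V) * ↑u⁻¹ = 1
    rw [← hu, Units.mul_inv]
  let a : S := ⟨A, hsS (by simp [s])⟩
  let b : S := ⟨B, hsS (by simp [s])⟩
  let j : S := ⟨T, hsS (by simp [s])⟩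
  let P : Quaternion ℝ → S → S := fun p x => x * x - (2 * p.re) • x + ‖p‖ ^ 2 • 1
  have hP : ∀ p x, ((P p x : S) : V →L[ℝ] V) = pseudoRes p (x : V →L[ℝ] V) := fun p x => rfl
  have hx : ¬ IsUnit (P q (a + b)) := by
    intro h
    have h1 : IsUnit ((P q (a + b) : S) : V →L[ℝ] V) := h.map S.val
    exact hq (ContinuousLinearMap.isUnit_iff_bijective.1 h1)
  obtain ⟨h, hr, h0⟩ := aux_char j (Subtype.ext hTT) (fun z x => hTn z x) _ hx
  have hPh : ∀ p x, h (P p x) = h x * h x - (2 * p.re : ℝ) * h x + ((‖p‖ ^ 2 : ℝ) : ℂ) := by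
    intro p x
    simp only [P, map_add, map_sub, map_mul, hr, map_one, mul_one]
  have hmem : ∀ p x, h (P p x) = 0 → p ∈ sigmaS (x : V →L[ℝ] V) := by
    intro p x h1 h2
    have h3 := hunit (P p x) (ContinuousLinearMap.isUnit_iff_bijective.2 h2)
    exact (h3.map h).ne_zero h1
  rw [hPh, hqn, map_add] at h0
  have key : ∀ K : Quaternion ℝ, K.re = 0 → K.imI ^ 2 + K.imJ ^ 2 + K.imK ^ 2 = 1 → ∀ x : S,
      ((h x).re : Quaternion ℝ) + (h x).im • K ∈ sigmaS (x : V →L[ℝ] V) := by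
    intro K hK0 hK1 x
    apply hmem
    rw [hPh, aux_norm K hK0 hK1]
    apply Complex.ext <;> simp [hK0, sq] <;> ring
  obtain ⟨hre, him⟩ := aux_complex _ _ _ h0
  rw [Complex.add_re] at hre
  rw [Complex.add_im] at him
  rcases him with him | him
  · refine ⟨_, key J hJ0 hJ1 a, _, key J hJ0 hJ1 b, ?_⟩
    change _ + _ = _
    rw [hqJ, ← hre, ← him, Quaternion.coe_add, add_smul]
    abel
  · refine ⟨_, key (-J) (by simp [hJ0]) (by simpa using hJ1) a, _,
      key (-J) (by simp [hJ0]) (by simpa using hJ1) b, ?_⟩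
    change _ + _ = _
    have : y = -((h a).im + (h b).im) := by linarith
    rw [hqJ, ← hre, this, Quaternion.coe_add, neg_smul, add_smul]
    simp only [smul_neg, neg_add]
    abel
end
end

section
/- Let V be nontrivial and let S be a bounded right ℍ-linear operator on V. Then the approximate point S-spectrum of the left-multiplication operator L_S on B(V) equals the approximate point S-spectrum of S: σ_ap(L_S) = σ_ap(S). -/
open MulOpposite Filter Pointwise

noncomputable section

variable {V : Type*} [NormedAddCommGroup V] [NormedSpace ℝ V] [CompleteSpace V]
  [Module (Quaternion ℝ)ᵐᵒᵖ V] [IsScalarTower ℝ (Quaternion ℝ)ᵐᵒᵖ V]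
  [SMulCommClass ℝ (Quaternion ℝ)ᵐᵒᵖ V]

/-- `B(V)`: the space of bounded right `ℍ`-linear operators on `V`, as a real subspace of the
bounded real-linear operators, with the induced (operator) norm. -/
def BV (V : Type*) [NormedAddCommGroup V] [NormedSpace ℝ V]
    [Module (Quaternion ℝ)ᵐᵒᵖ V] [SMulCommClass ℝ (Quaternion ℝ)ᵐᵒᵖ V] :
    Submodule ℝ (V →L[ℝ] V) where
  carrier := {A | RightLinear A}
  add_mem' {A B} hA hB := fun q v => by
    simp only [ContinuousLinearMap.add_apply, hA q v, hB q v, smul_add]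
  zero_mem' := fun q v => by simp
  smul_mem' c A hA := fun q v => by
    rw [ContinuousLinearMap.smul_apply, ContinuousLinearMap.smul_apply, hA q v]
    exact smul_comm c (op q) (A v)

/-- The left-multiplication operator `L_S : B(V) → B(V)`, `L_S(A) = S ∘ A`. -/
def opL (S : V →L[ℝ] V) (hS : RightLinear S) : BV V → BV V :=
  fun A => ⟨S.comp A.1, fun q v => by
    simp only [ContinuousLinearMap.comp_apply, A.2 q v, hS q (A.1 v)]⟩

/-- The right-multiplication operator `R_T : B(V) → B(V)`, `R_T(A) = A ∘ T`. -/
def opR (T : V →L[ℝ] V) (hT : RightLinear T) : BV V → BV V :=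
  fun A => ⟨A.1.comp T, fun q v => by
    simp only [ContinuousLinearMap.comp_apply, hT q v, A.2 q (T v)]⟩

/-- The commutator operator `C(S,T) : B(V) → B(V)`, `C(S,T)(A) = S ∘ A - A ∘ T`. -/
def commOp (S T : V →L[ℝ] V) (hS : RightLinear S) (hT : RightLinear T) : BV V → BV V :=
  fun A => opL S hS A - opR T hT A

/-- The pseudo-resolvent `R_q(Φ) = Φ² - 2(Re q)Φ + |q|² I` of an operator `Φ` on `B(V)`. -/
def pseudoResOp (q : Quaternion ℝ) (Φ : BV V → BV V) : BV V → BV V :=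
  fun A => Φ (Φ A) - (2 * q.re) • Φ A + ‖q‖ ^ 2 • A

/-- The approximate point S-spectrum of an operator `Φ` on `B(V)`. -/
def sigmaApOp (Φ : BV V → BV V) : Set (Quaternion ℝ) :=
  {q | ∃ As : ℕ → BV V, (∀ n, ‖As n‖ = 1) ∧
    Tendsto (fun n => ‖pseudoResOp q Φ (As n)‖) atTop (nhds 0)}

/-- The surjectivity S-spectrum of an operator `Φ` on `B(V)`. -/
def sigmaSuOp (Φ : BV V → BV V) : Set (Quaternion ℝ) :=
  {q | ¬ Function.Surjective (pseudoResOp q Φ)}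

/-- The S-spectrum of an operator `Φ` on `B(V)`. -/
def sigmaSOp (Φ : BV V → BV V) : Set (Quaternion ℝ) :=
  {q | ¬ Function.Bijective (pseudoResOp q Φ)}

/-- Right multiplication by a quaternion. -/
def rmulAux (hnorm : ∀ (q : Quaternion ℝ) (v : V), ‖op q • v‖ = ‖v‖ * ‖q‖)
    (q : Quaternion ℝ) : V →L[ℝ] V :=
  LinearMap.mkContinuous
    { toFun := fun v => op q • v
      map_add' := fun v w => smul_add _ _ _
      map_smul' := fun r v => (smul_comm r (op q) v).symm } ‖q‖
    (fun v => by
      change ‖op q • v‖ ≤ _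
      rw [hnorm, mul_comm])

open scoped Quaternion in
theorem functional_aux [Nontrivial V]
    (hnorm : ∀ (q : Quaternion ℝ) (v : V), ‖op q • v‖ = ‖v‖ * ‖q‖) :
    ∃ f : V →L[ℝ] Quaternion ℝ, ‖f‖ ≠ 0 ∧ ∀ q v, f (op q • v) = f v * q := by
  obtain ⟨v₀, hv₀⟩ := exists_ne (0 : V)
  obtain ⟨g, -, hg⟩ := exists_dual_vector ℝ v₀ (norm_ne_zero_iff.2 hv₀)
  obtain ⟨i, i1, i2, i3, i4⟩ : ∃ x : Quaternion ℝ, x.re = 0 ∧ x.imI = 1 ∧ x.imJ = 0 ∧ x.imK = 0 :=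
    ⟨⟨0, 1, 0, 0⟩, rfl, rfl, rfl, rfl⟩
  obtain ⟨j, j1, j2, j3, j4⟩ : ∃ x : Quaternion ℝ, x.re = 0 ∧ x.imI = 0 ∧ x.imJ = 1 ∧ x.imK = 0 :=
    ⟨⟨0, 0, 1, 0⟩, rfl, rfl, rfl, rfl⟩
  obtain ⟨k, k1, k2, k3, k4⟩ : ∃ x : Quaternion ℝ, x.re = 0 ∧ x.imI = 0 ∧ x.imJ = 0 ∧ x.imK = 1 :=
    ⟨⟨0, 0, 0, 1⟩, rfl, rfl, rfl, rfl⟩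
  let f : V →L[ℝ] Quaternion ℝ := g.smulRight 1 - (g.comp (rmulAux hnorm i)).smulRight i
    - (g.comp (rmulAux hnorm j)).smulRight j - (g.comp (rmulAux hnorm k)).smulRight k
  have hf : ∀ v, (f v).re = g v ∧ (f v).imI = -g (op i • v) ∧ (f v).imJ = -g (op j • v) ∧
      (f v).imK = -g (op k • v) := by
    intro v
    have : f v = g v • (1 : Quaternion ℝ) - g (op i • v) • i - g (op j • v) • j
      - g (op k • v) • k := rfl
    rw [this]
    refine ⟨?_, ?_, ?_, ?_⟩ <;> simp [i1, i2, i3, i4, j1, j2, j3, j4, k1, k2, k3, k4]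
  have hx : ∀ (x : Quaternion ℝ) v, g (op x • v) = x.re * g v + x.imI * g (op i • v)
      + x.imJ * g (op j • v) + x.imK * g (op k • v) := by
    intro x v
    have e : x = x.re • (1 : Quaternion ℝ) + x.imI • i + x.imJ • j + x.imK • k := by
      ext <;> simp [i1, i2, i3, i4, j1, j2, j3, j4, k1, k2, k3, k4]
    conv_lhs => rw [e]
    simp only [op_add, op_smul, op_one, add_smul, smul_assoc, one_smul, map_add, map_smul,
      smul_eq_mul]
  refine ⟨f, ?_, ?_⟩
  · intro h0
    have h2 : f v₀ = 0 := by
      have h3 := f.le_opNorm v₀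
      rw [h0, zero_mul] at h3
      exact norm_le_zero_iff.1 h3
    have h1 := (hf v₀).1
    rw [h2, hg] at h1
    exact hv₀ (norm_eq_zero.1 h1.symm)
  · intro q v
    obtain ⟨a1, a2, a3, a4⟩ := hf v
    obtain ⟨b1, b2, b3, b4⟩ := hf (op q • v)
    simp only [← mul_smul, ← op_mul] at b1 b2 b3 b4
    rw [hx q] at b1
    rw [hx (q * i)] at b2
    rw [hx (q * j)] at b3
    rw [hx (q * k)] at b4
    ext <;> simp [a1, a2, a3, a4, b1, b2, b3, b4, i1, i2, i3, i4, j1, j2, j3, j4, k1, k2, k3, k4] <;> ring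

theorem pseudoResOp_opL_apply (S : V →L[ℝ] V) (hS : RightLinear S) (q : Quaternion ℝ) (A : BV V)
    (v : V) : (pseudoResOp q (opL S hS) A).1 v = pseudoRes q S (A.1 v) := rfl

theorem sigmaAp_opL [Nontrivial V] (hnorm : ∀ (q : Quaternion ℝ) (v : V), ‖op q • v‖ = ‖v‖ * ‖q‖)
    (S : V →L[ℝ] V) (hS : RightLinear S) :
    sigmaApOp (opL S hS) = sigmaAp S := by
  ext q
  constructor
  · rintro ⟨As, h1, h2⟩
    have hex : ∀ n, ∃ v, (1 / 2 : ℝ) * ‖v‖ < ‖(As n).1 v‖ := by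
      intro n
      by_contra! hc
      have h3 := ContinuousLinearMap.opNorm_le_bound (As n).1 (by norm_num) hc
      have h4 : ‖(As n).1‖ = 1 := h1 n
      linarith
    choose v hv using hex
    have hpos : ∀ n, 0 < ‖(As n).1 (v n)‖ := fun n =>
      lt_of_le_of_lt (by positivity) (hv n)
    refine ⟨fun n => ‖(As n).1 (v n)‖⁻¹ • (As n).1 (v n), ?_, ?_⟩
    · intro n
      rw [norm_smul, norm_inv, norm_norm, inv_mul_cancel₀ (hpos n).ne']
    · refine squeeze_zero (fun n => norm_nonneg _) (fun n => ?_)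
        (by rw [← mul_zero (2 : ℝ)]; exact h2.const_mul (2 : ℝ))
      rw [map_smul, norm_smul, norm_inv, norm_norm, ← pseudoResOp_opL_apply S hS,
        inv_mul_le_iff₀ (hpos n)]
      have h3 := (pseudoResOp q (opL S hS) (As n)).1.le_opNorm (v n)
      have h4 : ‖(pseudoResOp q (opL S hS) (As n)).1‖ = ‖pseudoResOp q (opL S hS) (As n)‖ := rfl
      rw [h4] at h3
      have h5 := norm_nonneg (pseudoResOp q (opL S hS) (As n))
      nlinarith [hv n]
  · rintro ⟨φ, h1, h2⟩
    obtain ⟨f, hf1, hf⟩ := functional_aux hnorm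
    obtain ⟨c, hc, hb, hl⟩ : ∃ c : ℝ, 0 < c ∧ (∀ v, ‖f v‖ ≤ c * ‖v‖) ∧
        ∀ M : ℝ, 0 ≤ M → (∀ v, ‖f v‖ ≤ M * ‖v‖) → c ≤ M :=
      ⟨‖f‖, lt_of_le_of_ne f.opNorm_nonneg hf1.symm, f.le_opNorm,
        fun M hM h => f.opNorm_le_bound hM h⟩
    let A : V → (V →L[ℝ] V) := fun w => LinearMap.mkContinuous
      { toFun := fun v => op (f v) • w
        map_add' := fun v v' => by rw [map_add, op_add, add_smul]
        map_smul' := fun r v => by rw [map_smul, op_smul, smul_assoc]; rfl } (‖w‖ * c)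
      (fun v => by
        change ‖op (f v) • w‖ ≤ _
        rw [hnorm, mul_assoc]
        gcongr
        exact hb v)
    have hA : ∀ w v, A w v = op (f v) • w := fun _ _ => rfl
    have hAR : ∀ w, RightLinear (A w) := by
      intro w p v
      rw [hA, hA, hf, op_mul, mul_smul]
    have hR : ∀ B : V →L[ℝ] V, RightLinear B → RightLinear (pseudoRes q B) := by
      intro B hB p v
      simp only [pseudoRes, ContinuousLinearMap.add_apply, ContinuousLinearMap.sub_apply,
        ContinuousLinearMap.smul_apply, ContinuousLinearMap.comp_apply,
        ContinuousLinearMap.id_apply, hB p, smul_add, smul_sub, smul_comm _ (op p)]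
    have hAn : ∀ n, ‖A (φ n)‖ = c := by
      intro n
      apply le_antisymm
      · refine ContinuousLinearMap.opNorm_le_bound _ hc.le (fun v => ?_)
        rw [hA, hnorm, h1, one_mul]
        exact hb v
      · refine hl _ (norm_nonneg _) (fun v => ?_)
        have := (A (φ n)).le_opNorm v
        rwa [hA, hnorm, h1, one_mul] at this
    refine ⟨fun n => c⁻¹ • (⟨A (φ n), hAR _⟩ : BV V), ?_, ?_⟩
    · intro n
      change ‖c⁻¹ • A (φ n)‖ = 1
      rw [norm_smul, norm_inv, Real.norm_of_nonneg hc.le, hAn, inv_mul_cancel₀ hc.ne']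
    · refine squeeze_zero (fun n => norm_nonneg _) (fun n => ?_) h2
      refine ContinuousLinearMap.opNorm_le_bound _ (norm_nonneg _) (fun v => ?_)
      change ‖pseudoRes q S (c⁻¹ • op (f v) • φ n)‖ ≤ _
      rw [map_smul, norm_smul, norm_inv, Real.norm_of_nonneg hc.le, hR S hS, hnorm,
        inv_mul_le_iff₀ hc]
      calc ‖pseudoRes q S (φ n)‖ * ‖f v‖ ≤ ‖pseudoRes q S (φ n)‖ * (c * ‖v‖) := by
            gcongr
            exact hb v
        _ = _ := by ring
end
end

section
/- Let V be nontrivial and let T be a bounded right ℍ-linear operator on V. Then the approximate point S-spectrum of the right-multiplication operator R_T on B(V) equals the surjectivity S-spectrum of T: σ_ap(R_T) = σ_su(T). -/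
open MulOpposite Filter Pointwise

noncomputable section

variable {V : Type*} [NormedAddCommGroup V] [NormedSpace ℝ V] [CompleteSpace V]
  [Module (Quaternion ℝ)ᵐᵒᵖ V] [IsScalarTower ℝ (Quaternion ℝ)ᵐᵒᵖ V]
  [SMulCommClass ℝ (Quaternion ℝ)ᵐᵒᵖ V]

theorem aux_surj {E : Type*} [NormedAddCommGroup E] [NormedSpace ℝ E] [CompleteSpace E]
    (R : E →L[ℝ] E) (C : ℝ)
    (h : ∀ y : E, ∃ x : E, ‖x‖ ≤ C * ‖y‖ ∧ ‖y - R x‖ ≤ 1 / 2 * ‖y‖) :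
    Function.Surjective R := by
  choose g hg1 hg2 using h
  intro y
  let Y : ℕ → E := fun n => (fun z => z - R (g z))^[n] y
  have hY0 : Y 0 = y := rfl
  have hYs : ∀ n, Y (n + 1) = Y n - R (g (Y n)) := fun n => by
    simp only [Y, Function.iterate_succ_apply']
  have hYn : ∀ n, ‖Y n‖ ≤ (1 / 2) ^ n * ‖y‖ := by
    intro n
    induction n with
    | zero => simp [hY0]
    | succ k ih =>
      rw [hYs, pow_succ]
      have := hg2 (Y k)
      linarith
  have hsum : Summable (fun n => g (Y n)) := by
    refine Summable.of_norm_bounded (g := fun n => |C| * ‖y‖ * (1 / 2) ^ n) ?_ ?_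
    · exact (summable_geometric_of_lt_one (by norm_num) (by norm_num)).mul_left _
    · intro n
      calc ‖g (Y n)‖ ≤ C * ‖Y n‖ := hg1 _
        _ ≤ |C| * ‖Y n‖ := by gcongr; exact le_abs_self C
        _ ≤ |C| * ((1 / 2) ^ n * ‖y‖) := by gcongr; exact hYn n
        _ = _ := by ring
  have hpart : ∀ n, R (∑ i ∈ Finset.range n, g (Y i)) = y - Y n := by
    intro n
    induction n with
    | zero => simp [hY0]
    | succ k ih =>
      rw [Finset.sum_range_succ, map_add, ih, hYs]
      abel
  refine ⟨∑' n, g (Y n), ?_⟩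
  have h1 : Tendsto (fun n => R (∑ i ∈ Finset.range n, g (Y i))) atTop
      (nhds (R (∑' n, g (Y n)))) :=
    (R.continuous.tendsto _).comp hsum.hasSum.tendsto_sum_nat
  have hY : Tendsto Y atTop (nhds 0) := by
    refine squeeze_zero_norm hYn ?_
    have := (tendsto_pow_atTop_nhds_zero_of_lt_one (r := (1 / 2 : ℝ))
      (by norm_num) (by norm_num)).mul_const ‖y‖
    simpa using this
  have h2 : Tendsto (fun n => R (∑ i ∈ Finset.range n, g (Y i))) atTop (nhds y) := by
    simp only [hpart]
    simpa using tendsto_const_nhds.sub hY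
  exact tendsto_nhds_unique h1 h2

theorem aux_func {E : Type*} [NormedAddCommGroup E] [NormedSpace ℝ E] [CompleteSpace E]
    (R : E →L[ℝ] E) (hR : ¬ Function.Surjective R) (C : ℝ) (hC : 0 < C) :
    ∃ f : E →L[ℝ] ℝ, f ≠ 0 ∧ C * ‖f.comp R‖ ≤ ‖f‖ := by
  by_contra! hcon
  apply hR
  have key : ∀ y : E, ‖y‖ ≤ 1 → y ∈ closure (R '' Metric.closedBall 0 C) := by
    intro y hy
    by_contra hmem
    obtain ⟨f, u, hfu, huy⟩ := geometric_hahn_banach_closed_point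
      (((convex_closedBall (0 : E) C).linear_image R.toLinearMap).closure) isClosed_closure hmem
    have hlt : ∀ x : E, ‖x‖ ≤ C → f (R x) < u := fun x hx =>
      hfu _ (subset_closure ⟨x, by simpa using hx, rfl⟩)
    have hu0 : 0 < u := by simpa using hlt 0 (by simpa using hC.le)
    have hfy : f y ≤ ‖f‖ := by
      calc f y ≤ ‖f y‖ := le_abs_self _
        _ ≤ ‖f‖ * ‖y‖ := f.le_opNorm y
        _ ≤ ‖f‖ * 1 := by gcongr
        _ = _ := mul_one _
    have hf0 : f ≠ 0 := by
      rintro rfl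
      simp at huy
      linarith
    have h1 := hcon f hf0
    have h2 : ‖f.comp R‖ ≤ u / C := by
      refine ContinuousLinearMap.opNorm_le_of_ball hC (by positivity) ?_
      intro x hx
      by_cases hx0 : x = 0
      · simp [hx0]
      have hxn : 0 < ‖x‖ := norm_pos_iff.2 hx0
      have hn : ‖(C / ‖x‖) • x‖ ≤ C := by
        rw [norm_smul, norm_div, norm_norm, Real.norm_of_nonneg hC.le, div_mul_cancel₀ _ hxn.ne']
      have a1 := hlt _ hn
      have a2 := hlt (-((C / ‖x‖) • x)) (by rw [norm_neg]; exact hn)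
      simp only [map_neg, map_smul, smul_eq_mul] at a1 a2
      have a3 : C / ‖x‖ * |f (R x)| ≤ u := by
        rcases abs_cases (f (R x)) with h | h <;> rw [h.1] <;> linarith
      rw [ContinuousLinearMap.comp_apply, Real.norm_eq_abs]
      rw [div_mul_eq_mul_div, div_le_iff₀ hxn] at a3
      rw [div_mul_eq_mul_div, le_div_iff₀ hC]
      linarith
    rw [le_div_iff₀ hC] at h2
    linarith
  refine aux_surj R C fun y => ?_
  by_cases hy0 : y = 0
  · exact ⟨0, by simp [hy0]⟩
  have hyn : 0 < ‖y‖ := norm_pos_iff.2 hy0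
  have := key (‖y‖⁻¹ • y) (by rw [norm_smul, norm_inv, norm_norm, inv_mul_cancel₀ hyn.ne'])
  rw [Metric.mem_closure_iff] at this
  obtain ⟨_, ⟨x, hx, rfl⟩, hd⟩ := this (1 / 2) (by norm_num)
  have hx' : ‖x‖ ≤ C := by simpa using hx
  refine ⟨‖y‖ • x, ?_, ?_⟩
  · rw [norm_smul, norm_norm, mul_comm]; gcongr
  · have e : y - R (‖y‖ • x) = ‖y‖ • (‖y‖⁻¹ • y - R x) := by
      rw [smul_sub, smul_smul, mul_inv_cancel₀ hyn.ne', one_smul, map_smul]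
    rw [e, norm_smul, norm_norm, mul_comm]
    rw [dist_eq_norm] at hd
    gcongr

def qI : Quaternion ℝ := ⟨0, 1, 0, 0⟩
def qJ : Quaternion ℝ := ⟨0, 0, 1, 0⟩
def qK : Quaternion ℝ := ⟨0, 0, 0, 1⟩

@[simp] theorem qI_re : qI.re = 0 := rfl
@[simp] theorem qI_imI : qI.imI = 1 := rfl
@[simp] theorem qI_imJ : qI.imJ = 0 := rfl
@[simp] theorem qI_imK : qI.imK = 0 := rfl
@[simp] theorem qJ_re : qJ.re = 0 := rfl
@[simp] theorem qJ_imI : qJ.imI = 0 := rfl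
@[simp] theorem qJ_imJ : qJ.imJ = 1 := rfl
@[simp] theorem qJ_imK : qJ.imK = 0 := rfl
@[simp] theorem qK_re : qK.re = 0 := rfl
@[simp] theorem qK_imI : qK.imI = 0 := rfl
@[simp] theorem qK_imJ : qK.imJ = 0 := rfl
@[simp] theorem qK_imK : qK.imK = 1 := rfl

def qF (f : V →L[ℝ] ℝ) (v : V) : Quaternion ℝ :=
  ⟨f v, -f (op qI • v), -f (op qJ • v), -f (op qK • v)⟩

@[simp] theorem qF_re (f : V →L[ℝ] ℝ) (v : V) : (qF f v).re = f v := rfl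
@[simp] theorem qF_imI (f : V →L[ℝ] ℝ) (v : V) : (qF f v).imI = -f (op qI • v) := rfl
@[simp] theorem qF_imJ (f : V →L[ℝ] ℝ) (v : V) : (qF f v).imJ = -f (op qJ • v) := rfl
@[simp] theorem qF_imK (f : V →L[ℝ] ℝ) (v : V) : (qF f v).imK = -f (op qK • v) := rfl

theorem aux_expand (f : V →L[ℝ] ℝ) (v : V) (q : Quaternion ℝ) :
    f (op q • v) = q.re * f v + q.imI * f (op qI • v) + q.imJ * f (op qJ • v)
      + q.imK * f (op qK • v) := by
  have h : op q = q.re • (1 : (Quaternion ℝ)ᵐᵒᵖ) + q.imI • op qI + q.imJ • op qJ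
      + q.imK • op qK := by
    apply unop_injective
    simp only [unop_add, unop_smul, unop_op, unop_one]
    have r1 : (1 : Quaternion ℝ).re = 1 := rfl
    have r2 : (1 : Quaternion ℝ).imI = 0 := rfl
    have r3 : (1 : Quaternion ℝ).imJ = 0 := rfl
    have r4 : (1 : Quaternion ℝ).imK = 0 := rfl
    ext <;> simp [r1, r2, r3, r4]
  rw [h]
  simp only [add_smul, smul_assoc, one_smul, map_add, map_smul, smul_eq_mul]

theorem qF_smul (f : V →L[ℝ] ℝ) (p : Quaternion ℝ) (v : V) :
    qF f (op p • v) = qF f v * p := by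
  have h : ∀ e : Quaternion ℝ, op e • op p • v = op (p * e) • v := fun e => by
    rw [smul_smul, ← op_mul]
  ext <;> simp only [qF_re, qF_imI, qF_imJ, qF_imK, h, aux_expand f v (p * _), aux_expand f v p, Quaternion.re_mul,
    Quaternion.imI_mul, Quaternion.imJ_mul, Quaternion.imK_mul] <;> simp <;> ring

theorem qF_norm_le (f : V →L[ℝ] ℝ) (v : V) (M : ℝ) (hM : 0 ≤ M)
    (h : ∀ e : Quaternion ℝ, ‖e‖ = 1 → |f (op e • v)| ≤ M) : ‖qF f v‖ ≤ 2 * M := by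
  have n1 : ∀ e : Quaternion ℝ, e.re ^ 2 + e.imI ^ 2 + e.imJ ^ 2 + e.imK ^ 2 = 1 → ‖e‖ = 1 := by
    intro e he
    rw [← Quaternion.normSq_def', Quaternion.normSq_eq_norm_mul_self] at he
    nlinarith [norm_nonneg e]
  have h0 := h 1 (by simp)
  have hi := h qI (n1 _ (by simp))
  have hj := h qJ (n1 _ (by simp))
  have hk := h qK (n1 _ (by simp))
  rw [op_one, one_smul] at h0
  have e : ‖qF f v‖ * ‖qF f v‖ = f v ^ 2 + f (op qI • v) ^ 2 + f (op qJ • v) ^ 2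
      + f (op qK • v) ^ 2 := by
    rw [← Quaternion.normSq_eq_norm_mul_self, Quaternion.normSq_def']
    simp
  have s : ∀ a : ℝ, |a| ≤ M → a ^ 2 ≤ M ^ 2 := fun a ha => sq_le_sq' (abs_le.1 ha).1 (abs_le.1 ha).2
  refine abs_le_of_sq_le_sq' ?_ (by positivity) |>.2
  nlinarith [s _ h0, s _ hi, s _ hj, s _ hk]

theorem aux_op [Nontrivial V] (hnorm : ∀ (q : Quaternion ℝ) (v : V), ‖op q • v‖ = ‖v‖ * ‖q‖)
    (R : V →L[ℝ] V) (hR : RightLinear R) (f : V →L[ℝ] ℝ) :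
    ∃ A : BV V, ‖f‖ ≤ ‖A‖ ∧ ‖A.1.comp R‖ ≤ 2 * ‖f.comp R‖ := by
  obtain ⟨u, hu⟩ := exists_norm_eq V (zero_le_one (α := ℝ))
  have hb : ∀ (g : V →L[ℝ] ℝ) (v : V), ‖qF g v‖ ≤ 2 * ‖g‖ * ‖v‖ := by
    intro g v
    rw [mul_assoc]
    refine qF_norm_le g v _ (by positivity) fun e he => ?_
    have := g.le_opNorm (op e • v)
    rwa [hnorm, he, mul_one] at this
  have hA : ∀ v, ‖op (qF f v) • u‖ = ‖qF f v‖ := fun v => by rw [hnorm, hu, one_mul]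
  let L : V →ₗ[ℝ] V :=
    { toFun := fun v => op (qF f v) • u
      map_add' := fun x y => by
        rw [← add_smul, ← op_add]
        congr 2
        ext <;> simp <;> ring
      map_smul' := fun c x => by
        rw [RingHom.id_apply, ← smul_assoc, ← op_smul]
        congr 2
        ext <;> simp [smul_comm _ c x] }
  let A : V →L[ℝ] V := L.mkContinuous (2 * ‖f‖) (fun v => by
    change ‖op (qF f v) • u‖ ≤ _
    rw [hA]; exact hb f v)
  have hAv : ∀ v, A v = op (qF f v) • u := fun v => rfl
  refine ⟨⟨A, fun q v => ?_⟩, ?_, ?_⟩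
  · rw [hAv, hAv, qF_smul, op_mul, mul_smul]
  · change ‖f‖ ≤ ‖A‖
    refine f.opNorm_le_bound (norm_nonneg _) fun v => ?_
    refine le_trans ?_ (A.le_opNorm v)
    rw [hAv, hA]
    refine abs_le_of_sq_le_sq ?_ (norm_nonneg _)
    rw [sq ‖_‖, ← Quaternion.normSq_eq_norm_mul_self, Quaternion.normSq_def']
    simp only [qF_re, qF_imI, qF_imJ, qF_imK]
    nlinarith [sq_nonneg (f (op qI • v)), sq_nonneg (f (op qJ • v)), sq_nonneg (f (op qK • v))]
  · change ‖A.comp R‖ ≤ _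
    refine ContinuousLinearMap.opNorm_le_bound _ (by positivity) fun v => ?_
    rw [ContinuousLinearMap.comp_apply, hAv, hA]
    have : qF f (R v) = qF (f.comp R) v := by
      ext <;> simp [hR _ v]
    rw [this]
    exact hb _ v

theorem pseudoRes_rightLinear (T : V →L[ℝ] V) (hT : RightLinear T) (q : Quaternion ℝ) :
    RightLinear (pseudoRes q T) := by
  intro p v
  simp [pseudoRes, hT p, smul_add, smul_sub, smul_comm _ (op p)]

theorem pseudoResOp_opR (T : V →L[ℝ] V) (hT : RightLinear T) (q : Quaternion ℝ) (A : BV V) :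
    (pseudoResOp q (opR T hT) A).1 = A.1.comp (pseudoRes q T) := by
  ext v
  simp [pseudoResOp, pseudoRes, opR]

theorem sigmaAp_opR [Nontrivial V] (hnorm : ∀ (q : Quaternion ℝ) (v : V), ‖op q • v‖ = ‖v‖ * ‖q‖)
    (T : V →L[ℝ] V) (hT : RightLinear T) :
    sigmaApOp (opR T hT) = sigmaSu T := by
  ext q
  constructor
  · rintro ⟨As, h1, h2⟩ hs
    obtain ⟨C, hC, hpre⟩ := (pseudoRes q T).exists_preimage_norm_le hs
    have hb : ∀ n, 1 ≤ C * ‖pseudoResOp q (opR T hT) (As n)‖ := by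
      intro n
      rw [← h1 n]
      change ‖(As n).1‖ ≤ C * ‖(pseudoResOp q (opR T hT) (As n)).1‖
      rw [pseudoResOp_opR]
      refine ContinuousLinearMap.opNorm_le_bound _ (by positivity) fun v => ?_
      obtain ⟨x, hx, hxn⟩ := hpre v
      calc ‖(As n).1 v‖ = ‖((As n).1.comp (pseudoRes q T)) x‖ := by
            rw [ContinuousLinearMap.comp_apply, hx]
        _ ≤ ‖(As n).1.comp (pseudoRes q T)‖ * ‖x‖ := ContinuousLinearMap.le_opNorm _ _
        _ ≤ ‖(As n).1.comp (pseudoRes q T)‖ * (C * ‖v‖) := by gcongr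
        _ = _ := by ring
    have := ge_of_tendsto' (h2.const_mul C) hb
    norm_num at this
  · intro hs
    have hs' : ¬ Function.Surjective (pseudoRes q T) := hs
    have key : ∀ n : ℕ, ∃ A : BV V, ‖A‖ = 1 ∧
        ‖pseudoResOp q (opR T hT) A‖ ≤ 2 * (1 / ((n : ℝ) + 1)) := by
      intro n
      have hn : (0 : ℝ) < n + 1 := by positivity
      obtain ⟨f, hf0, hf⟩ := aux_func _ hs' (n + 1) hn
      obtain ⟨A, hA1, hA2⟩ := aux_op hnorm _ (pseudoRes_rightLinear T hT q) f
      have hfp : 0 < ‖f‖ := norm_pos_iff.2 hf0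
      have hAp : 0 < ‖A‖ := hfp.trans_le hA1
      refine ⟨‖A‖⁻¹ • A, ?_, ?_⟩
      · change ‖‖A‖⁻¹ • A.1‖ = 1
        rw [norm_smul, norm_inv, Real.norm_of_nonneg hAp.le]
        exact inv_mul_cancel₀ hAp.ne'
      · change ‖(pseudoResOp q (opR T hT) (‖A‖⁻¹ • A)).1‖ ≤ _
        rw [pseudoResOp_opR]
        change ‖(‖A‖⁻¹ • A.1).comp (pseudoRes q T)‖ ≤ _
        rw [ContinuousLinearMap.smul_comp, norm_smul, norm_inv, Real.norm_of_nonneg hAp.le,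
          inv_mul_le_iff₀ hAp]
        have : ‖f.comp (pseudoRes q T)‖ ≤ ‖A‖ * (1 / ((n : ℝ) + 1)) := by
          rw [mul_one_div, le_div_iff₀ hn]
          linarith
        linarith
    choose As h1 h2 using key
    refine ⟨As, h1, squeeze_zero (fun _ => norm_nonneg _) h2 ?_⟩
    simpa using (tendsto_one_div_add_atTop_nhds_zero_nat (𝕜 := ℝ)).const_mul 2
end
end

section
/- Let T be a bounded right ℍ-linear operator on V. Then the S-spectrum of the right-multiplication operator R_T on B(V) is contained in the S-spectrum of T: σ_S(R_T) ⊆ σ_S(T). -/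
open MulOpposite Filter Pointwise

noncomputable section

variable {V : Type*} [NormedAddCommGroup V] [NormedSpace ℝ V] [CompleteSpace V]
  [Module (Quaternion ℝ)ᵐᵒᵖ V] [IsScalarTower ℝ (Quaternion ℝ)ᵐᵒᵖ V]
  [SMulCommClass ℝ (Quaternion ℝ)ᵐᵒᵖ V]

theorem sigmaS_opR_subset (hnorm : ∀ (q : Quaternion ℝ) (v : V), ‖op q • v‖ = ‖v‖ * ‖q‖)
    (T : V →L[ℝ] V) (hT : RightLinear T) :
    sigmaSOp (opR T hT) ⊆ sigmaS T := by
  intro q hq hb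
  apply hq
  set R := pseudoRes q T with hR
  have hval : ∀ A : BV V, (pseudoResOp q (opR T hT) A).1 = A.1.comp R := by
    intro A
    ext v
    simp [pseudoResOp, opR, hR, pseudoRes]
  have hRl : RightLinear R := by
    intro p v
    simp only [hR, pseudoRes, ContinuousLinearMap.add_apply, ContinuousLinearMap.sub_apply,
      ContinuousLinearMap.smul_apply, ContinuousLinearMap.comp_apply,
      ContinuousLinearMap.id_apply, hT p, smul_add, smul_sub]
    rw [smul_comm (2 * q.re) (op p), smul_comm (‖q‖ ^ 2) (op p)]
  let e : V ≃L[ℝ] V := ContinuousLinearEquiv.ofBijective R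
    (LinearMap.ker_eq_bot.2 hb.1) (LinearMap.range_eq_top.2 hb.2)
  have he : ∀ v, e v = R v := fun v => rfl
  have hel : RightLinear (e.symm : V →L[ℝ] V) := by
    intro p v
    apply e.injective
    simp [he, hRl p]
    simp [← he]
  constructor
  · intro A B hAB
    have h : A.1.comp R = B.1.comp R := by rw [← hval, ← hval, hAB]
    apply Subtype.ext
    ext v
    obtain ⟨w, rfl⟩ := hb.2 v
    exact congrArg (fun F : V →L[ℝ] V => F w) h
  · intro B
    refine ⟨⟨B.1.comp (e.symm : V →L[ℝ] V), fun p v => ?_⟩, ?_⟩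
    · rw [ContinuousLinearMap.comp_apply, hel p v, B.2 p]
      rfl
    · apply Subtype.ext
      rw [hval]
      ext v
      simp [← he]
end
end
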